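/- Let w > 0 be real, A a complex number, and B a real number with B > |A|². Then w·log(1 + |A|²/(B − |A|²)) equals the supremum over pairs (α, β) with α ∈ [0, ∞) and β ∈ ℂ of the function (α, β) ↦ w·(log(1 + α) − α) − |β|²·B + 2·√(w(1 + α))·Re(conj(β)·A). -/

import Mathlib

open Complex

/-- Completing the square: the quadratic transform is bounded by its value at the optimal `β`. -/
lemma quadratic_transform_le (A β : ℂ) {B s : ℝ} (hB : 0 < B) (hs : 0 ≤ s) :
    2 * s * ((starRingEnd ℂ) β * A).re - ‖β‖ ^ 2 * B ≤ s ^ 2 * ‖A‖ ^ 2 / B := by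
  have h : ((starRingEnd ℂ) β * A).re ≤ ‖β‖ * ‖A‖ := by
    simpa using Complex.re_le_norm ((starRingEnd ℂ) β * A)
  have h2 : s * ((starRingEnd ℂ) β * A).re ≤ s * (‖β‖ * ‖A‖) :=
    mul_le_mul_of_nonneg_left h hs
  rw [le_div_iff₀ hB]
  nlinarith [sq_nonneg (‖β‖ * B - s * ‖A‖), mul_le_mul_of_nonneg_right h2 hB.le]

/-- Equality in `quadratic_transform_le` at `β = (s / B) A`. -/
lemma quadratic_transform_eq (A : ℂ) {B : ℝ} (s : ℝ) (hB : 0 < B) :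
    2 * s * ((starRingEnd ℂ) (((s / B : ℝ) : ℂ) * A) * A).re
      - ‖((s / B : ℝ) : ℂ) * A‖ ^ 2 * B = s ^ 2 * ‖A‖ ^ 2 / B := by
  have h : (starRingEnd ℂ) (((s / B : ℝ) : ℂ) * A) * A
      = ((s / B * ‖A‖ ^ 2 : ℝ) : ℂ) := by
    rw [map_mul, Complex.conj_ofReal, mul_assoc, Complex.conj_mul']
    push_cast
    ring
  rw [h, Complex.ofReal_re, norm_mul, Complex.norm_real, mul_pow, Real.norm_eq_abs, sq_abs]
  field_simp
  ring

/-- The tangent-line bound for the logarithm at `r`. -/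
lemma log_le_log_add_div_sub_one {x r : ℝ} (hx : 0 < x) (hr : 0 < r) :
    Real.log x ≤ Real.log r + x / r - 1 := by
  have h := Real.log_le_sub_one_of_pos (div_pos hx hr)
  rw [Real.log_div hx.ne' hr.ne'] at h
  linarith

/-- Full fractional-programming reformulation (eq. (35)): for `w > 0`, `A ∈ ℂ`
and `B > |A|²`, the weighted rate `w·log(1 + |A|²/(B − |A|²))` equals the
supremum over `α ≥ 0` and `β ∈ ℂ` of
`w·(log(1+α) − α) − |β|²·B + 2·√(w(1+α))·Re(conj(β)·A)`. -/
theorem fp_rate_reformulation (w : ℝ) (hw : 0 < w) (A : ℂ) (B : ℝ)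
    (hB : ‖A‖ ^ 2 < B) :
    w * Real.log (1 + ‖A‖ ^ 2 / (B - ‖A‖ ^ 2))
      = sSup {y : ℝ | ∃ α : ℝ, 0 ≤ α ∧ ∃ β : ℂ,
          y = w * (Real.log (1 + α) - α) - ‖β‖ ^ 2 * B
              + 2 * Real.sqrt (w * (1 + α)) * ((starRingEnd ℂ) β * A).re} := by
  have hB0 : 0 < B := (sq_nonneg ‖A‖).trans_lt hB
  have hd : 0 < B - ‖A‖ ^ 2 := sub_pos.mpr hB
  have hα : 0 ≤ ‖A‖ ^ 2 / (B - ‖A‖ ^ 2) := by positivity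
  symm
  apply IsGreatest.csSup_eq
  refine ⟨⟨_, hα, ((√(w * (1 + ‖A‖ ^ 2 / (B - ‖A‖ ^ 2))) / B : ℝ) : ℂ) * A, ?_⟩, ?_⟩
  · have h := quadratic_transform_eq A (√(w * (1 + ‖A‖ ^ 2 / (B - ‖A‖ ^ 2)))) hB0
    rw [Real.sq_sqrt (by positivity)] at h
    have h2 : w * (1 + ‖A‖ ^ 2 / (B - ‖A‖ ^ 2)) * ‖A‖ ^ 2 / B
        = w * (‖A‖ ^ 2 / (B - ‖A‖ ^ 2)) := by
      field_simp
      ring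
    linarith
  · rintro y ⟨α, hα0, β, rfl⟩
    have h := quadratic_transform_le A β hB0 (Real.sqrt_nonneg (w * (1 + α)))
    rw [Real.sq_sqrt (by positivity)] at h
    have hlog := mul_le_mul_of_nonneg_left
      (log_le_log_add_div_sub_one (x := 1 + α) (r := 1 + ‖A‖ ^ 2 / (B - ‖A‖ ^ 2))
        (by positivity) (by positivity)) hw.le
    have h2 : w * (1 + α) * ‖A‖ ^ 2 / B
        = w * (1 + α) - w * ((1 + α) / (1 + ‖A‖ ^ 2 / (B - ‖A‖ ^ 2))) := by
      have hr : 1 + ‖A‖ ^ 2 / (B - ‖A‖ ^ 2) = B / (B - ‖A‖ ^ 2) := by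
        field_simp
        ring
      rw [hr]
      field_simp
      ring
    linarith
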